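/- For a linear pentapod design with planar base, det S is linear in the position variables if and only if [r,X,Y,rY] = 0 and [r,X,Y,rX] = 0. -/

import Mathlib

open Matrix

/-- The 7×7 matrix `S` of a linear pentapod design with platform parameters
`r` and base coordinates `x`, `y`, `z` (indices `1,…,4` of `Fin 5` correspond to
legs `2,…,5`; index `0` corresponds to leg `1`), at pose `(u,v,w,px,py,pz)`. -/
noncomputable def Smat (r x y z : Fin 5 → ℝ) (u v w px py pz : ℝ) :
    Matrix (Fin 7) (Fin 7) ℝ :=
  !![(1 : ℝ), u, v, w, px, py, pz;
     0, px, py, pz, 0, 0, 0;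
     0, 0, 0, 0, u, v, w;
     r 1, x 1, y 1, z 1, r 1 * x 1, r 1 * y 1, r 1 * z 1;
     r 2, x 2, y 2, z 2, r 2 * x 2, r 2 * y 2, r 2 * z 2;
     r 3, x 3, y 3, z 3, r 3 * x 3, r 3 * y 3, r 3 * z 3;
     r 4, x 4, y 4, z 4, r 4 * x 4, r 4 * y 4, r 4 * z 4]

/-- The 4×7 architecture matrix of the design. -/
noncomputable def archMat (r x y z : Fin 5 → ℝ) : Matrix (Fin 4) (Fin 7) ℝ :=
  !![r 1, x 1, y 1, z 1, r 1 * x 1, r 1 * y 1, r 1 * z 1;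
     r 2, x 2, y 2, z 2, r 2 * x 2, r 2 * y 2, r 2 * z 2;
     r 3, x 3, y 3, z 3, r 3 * x 3, r 3 * y 3, r 3 * z 3;
     r 4, x 4, y 4, z 4, r 4 * x 4, r 4 * y 4, r 4 * z 4]

/-- The design is architecturally singular: the singularity polynomial `det S`
vanishes at every pose on the quadric `u² + v² + w² = 1`. -/
def ArchSingular (r x y z : Fin 5 → ℝ) : Prop :=
  ∀ u v w px py pz : ℝ, u ^ 2 + v ^ 2 + w ^ 2 = 1 →
    (Smat r x y z u v w px py pz).det = 0

/-- The bracket `[A₁, A₂, A₃, A₄]`: the determinant of the 4×4 matrix with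
columns `A₁, A₂, A₃, A₄`. -/
noncomputable def bracket (A1 A2 A3 A4 : Fin 4 → ℝ) : ℝ :=
  (Matrix.of fun i j => ![A1, A2, A3, A4] j i).det

/-- The vector in `ℝ⁴` formed by the values of `f` at legs `2,…,5`. -/
def colVec (f : Fin 5 → ℝ) : Fin 4 → ℝ := fun i => f i.succ

/-- The componentwise product vector (e.g. `rX`, `rY`, `rZ`) for legs `2,…,5`. -/
def colProd (r f : Fin 5 → ℝ) : Fin 4 → ℝ := fun i => r i.succ * f i.succ

/-- The base anchor point `M_j = (x_j, y_j, z_j) ∈ ℝ³`. -/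
def Mpt (x y z : Fin 5 → ℝ) (j : Fin 5) : Fin 3 → ℝ := ![x j, y j, z j]

/-- Laplace expansion along the first row of a 5×5 determinant, in terms of `bracket`. -/
theorem det_five_eq_bracket
    (a b c d e
      r₁ r₂ r₃ r₄ x₁ x₂ x₃ x₄ y₁ y₂ y₃ y₄ s₁ s₂ s₃ s₄ t₁ t₂ t₃ t₄ : ℝ) :
    det !![a, b, c, d, e;
        r₁, x₁, y₁, s₁, t₁;
        r₂, x₂, y₂, s₂, t₂;
        r₃, x₃, y₃, s₃, t₃;
        r₄, x₄, y₄, s₄, t₄] =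
      a * bracket ![x₁, x₂, x₃, x₄] ![y₁, y₂, y₃, y₄] ![s₁, s₂, s₃, s₄] ![t₁, t₂, t₃, t₄]
      - b * bracket ![r₁, r₂, r₃, r₄] ![y₁, y₂, y₃, y₄] ![s₁, s₂, s₃, s₄] ![t₁, t₂, t₃, t₄]
      + c * bracket ![r₁, r₂, r₃, r₄] ![x₁, x₂, x₃, x₄] ![s₁, s₂, s₃, s₄] ![t₁, t₂, t₃, t₄]
      - d * bracket ![r₁, r₂, r₃, r₄] ![x₁, x₂, x₃, x₄] ![y₁, y₂, y₃, y₄] ![t₁, t₂, t₃, t₄]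
      + e * bracket ![r₁, r₂, r₃, r₄] ![x₁, x₂, x₃, x₄] ![y₁, y₂, y₃, y₄] ![s₁, s₂, s₃, s₄] := by
  rw [det_succ_row_zero, Fin.sum_univ_five]
  simp only [bracket]
  simp [det_succ_row_zero, Fin.sum_univ_succ, Fin.succAbove]
  ring

/-- Expansion of a 6×6 determinant along a last column supported on the first two rows. -/
theorem det_six_of_last_column
    (a b c d e f a' b' c' d' e' f'
      r₁ r₂ r₃ r₄ x₁ x₂ x₃ x₄ y₁ y₂ y₃ y₄ s₁ s₂ s₃ s₄ t₁ t₂ t₃ t₄ : ℝ) :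
    det !![a, b, c, d, e, f;
        a', b', c', d', e', f';
        r₁, x₁, y₁, s₁, t₁, 0;
        r₂, x₂, y₂, s₂, t₂, 0;
        r₃, x₃, y₃, s₃, t₃, 0;
        r₄, x₄, y₄, s₄, t₄, 0] =
      f' * det !![a, b, c, d, e;
        r₁, x₁, y₁, s₁, t₁;
        r₂, x₂, y₂, s₂, t₂;
        r₃, x₃, y₃, s₃, t₃;
        r₄, x₄, y₄, s₄, t₄]
      - f * det !![a', b', c', d', e';
        r₁, x₁, y₁, s₁, t₁;
        r₂, x₂, y₂, s₂, t₂;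
        r₃, x₃, y₃, s₃, t₃;
        r₄, x₄, y₄, s₄, t₄] := by
  rw [det_succ_column _ 5, Fin.sum_univ_six]
  simp
  rw [Odd.neg_one_pow (n := 5) (by decide), Even.neg_one_pow (n := 6) (by decide), neg_one_mul,
    neg_mul, one_mul, neg_add_eq_sub]
  refine congrArg₂ (· - ·) (congrArg (f' * det ·) ?_) (congrArg (f * det ·) ?_) <;>
    (ext i j; fin_cases i <;> fin_cases j <;> rfl)

/-- Expansion of the planar pentapod determinant along its two sparse columns. -/
theorem det_seven_of_sparse_columns
    (u v w px py pz
      r₁ r₂ r₃ r₄ x₁ x₂ x₃ x₄ y₁ y₂ y₃ y₄ s₁ s₂ s₃ s₄ t₁ t₂ t₃ t₄ : ℝ) :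
    det !![1, u, v, w, px, py, pz;
        0, px, py, pz, 0, 0, 0;
        0, 0, 0, 0, u, v, w;
        r₁, x₁, y₁, 0, s₁, t₁, 0;
        r₂, x₂, y₂, 0, s₂, t₂, 0;
        r₃, x₃, y₃, 0, s₃, t₃, 0;
        r₄, x₄, y₄, 0, s₄, t₄, 0] =
      pz * det !![1, u, v, px, py, pz;
        0, 0, 0, u, v, w;
        r₁, x₁, y₁, s₁, t₁, 0;
        r₂, x₂, y₂, s₂, t₂, 0;
        r₃, x₃, y₃, s₃, t₃, 0;
        r₄, x₄, y₄, s₄, t₄, 0]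
      - w * det !![0, px, py, 0, 0, 0;
        0, 0, 0, u, v, w;
        r₁, x₁, y₁, s₁, t₁, 0;
        r₂, x₂, y₂, s₂, t₂, 0;
        r₃, x₃, y₃, s₃, t₃, 0;
        r₄, x₄, y₄, s₄, t₄, 0] := by
  rw [det_succ_column _ 3, Fin.sum_univ_seven]
  simp
  rw [Odd.neg_one_pow (n := 3) (by decide), Even.neg_one_pow (n := 4) (by decide), neg_one_mul,
    neg_mul, one_mul, neg_add_eq_sub]
  refine congrArg₂ (· - ·) (congrArg (pz * det ·) ?_) (congrArg (w * det ·) ?_) <;>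
    (ext i j; fin_cases i <;> fin_cases j <;> rfl)

/-- For a planar base the last base column of `Smat` and its product column vanish below the pose
rows, so `det S` is a combination of the five maximal minors of the remaining columns. -/
theorem det_Smat_of_planar (r x y z : Fin 5 → ℝ) (hz : ∀ j, z j = 0) (u v w px py pz : ℝ) :
    (Smat r x y z u v w px py pz).det =
      pz * w * bracket (colVec x) (colVec y) (colProd r x) (colProd r y)
      - w * (u * pz - w * px) * bracket (colVec r) (colVec y) (colProd r x) (colProd r y)
      + w * (v * pz - w * py) * bracket (colVec r) (colVec x) (colProd r x) (colProd r y)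
      - pz * (px * w - pz * u) * bracket (colVec r) (colVec x) (colVec y) (colProd r y)
      + pz * (py * w - pz * v) * bracket (colVec r) (colVec x) (colVec y) (colProd r x) := by
  simp only [Smat, hz, mul_zero]
  rw [det_seven_of_sparse_columns, det_six_of_last_column, det_six_of_last_column,
    det_five_eq_bracket, det_five_eq_bracket, det_five_eq_bracket]
  have hvec (f : Fin 5 → ℝ) : colVec f = ![f 1, f 2, f 3, f 4] := by
    ext i; fin_cases i <;> rfl
  have hprod (f : Fin 5 → ℝ) :
      colProd r f = ![r 1 * f 1, r 2 * f 2, r 3 * f 3, r 4 * f 4] := by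
    ext i; fin_cases i <;> rfl
  simp only [hvec, hprod]
  ring

theorem stmt8 (r x y z : Fin 5 → ℝ)
    (hr1 : r 0 = 0) (hx1 : x 0 = 0) (hy1 : y 0 = 0) (hz1 : z 0 = 0)
    (hplanar : ∀ j, z j = 0) :
    (∀ u v w : ℝ, ∃ a b c d : ℝ, ∀ px py pz : ℝ,
        (Smat r x y z u v w px py pz).det = a * px + b * py + c * pz + d) ↔
      (bracket (colVec r) (colVec x) (colVec y) (colProd r y) = 0 ∧
        bracket (colVec r) (colVec x) (colVec y) (colProd r x) = 0) := by
  simp only [det_Smat_of_planar r x y z hplanar]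
  constructor
  · intro h
    constructor
    · obtain ⟨a, b, c, d, h⟩ := h 1 0 0
      linarith [h 0 0 0, h 0 0 1, h 0 0 (-1)]
    · obtain ⟨a, b, c, d, h⟩ := h 0 1 0
      linarith [h 0 0 0, h 0 0 1, h 0 0 (-1)]
  · rintro ⟨hY, hX⟩ u v w
    refine ⟨w * w * bracket (colVec r) (colVec y) (colProd r x) (colProd r y),
      -(w * w * bracket (colVec r) (colVec x) (colProd r x) (colProd r y)),
      w * bracket (colVec x) (colVec y) (colProd r x) (colProd r y)
        - w * u * bracket (colVec r) (colVec y) (colProd r x) (colProd r y)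
        + w * v * bracket (colVec r) (colVec x) (colProd r x) (colProd r y), 0,
      fun px py pz => ?_⟩
    rw [hY, hX]
    ring
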